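/- Let a be the boundary Lie algebra (basis h, h', e, f; nonzero brackets [h,e]=4p·e, [h,f]=-4p·f, [e,f]=(p/2)·h', p ≠ 0), let b = span{h, e} ⊆ a (a subalgebra) and n = span{h', f} ⊆ a (an abelian ideal, hence a b-module under the adjoint action of a). Then n is isomorphic as a Lie module over b to the coadjoint module b* (the dual space of b with action (x·ξ)(y) = -ξ([x,y]) for x, y ∈ b, ξ ∈ b*). Consequently a is the cotangent bundle Lie algebra b ⋉ b* of the two-dimensional Borel algebra b(2). -/

import Mathlib

noncomputable section
open scoped TensorProduct

noncomputable section

/-- The carrier of the boundary Lie algebra `a` (depends on the parameter `p`);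
coordinates are taken with respect to the basis `h, h', e, f`. -/
def BoundaryA (_p : ℂ) : Type := ℂ × ℂ × ℂ × ℂ

namespace BoundaryA

variable {p : ℂ}

instance : AddCommGroup (BoundaryA p) := inferInstanceAs (AddCommGroup (ℂ × ℂ × ℂ × ℂ))
instance : Module ℂ (BoundaryA p) := inferInstanceAs (Module ℂ (ℂ × ℂ × ℂ × ℂ))
instance : Module.Finite ℂ (BoundaryA p) := inferInstanceAs (Module.Finite ℂ (ℂ × ℂ × ℂ × ℂ))

/-- Build an element of `a` from its coordinates in the basis `h, h', e, f`. -/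
def mk' (a b c d : ℂ) : BoundaryA p := (a, b, c, d)

/-- coefficient of `h` -/
def cH (x : BoundaryA p) : ℂ := x.1
/-- coefficient of `h'` -/
def cH' (x : BoundaryA p) : ℂ := x.2.1
/-- coefficient of `e` -/
def cE (x : BoundaryA p) : ℂ := x.2.2.1
/-- coefficient of `f` -/
def cF (x : BoundaryA p) : ℂ := x.2.2.2

/-- The basis vector `h`. -/
def h : BoundaryA p := mk' 1 0 0 0
/-- The basis vector `h'`. -/
def h' : BoundaryA p := mk' 0 1 0 0
/-- The basis vector `e`. -/
def e : BoundaryA p := mk' 0 0 1 0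
/-- The basis vector `f`. -/
def f : BoundaryA p := mk' 0 0 0 1

/-- The bracket of the boundary Lie algebra `a`: the bilinear antisymmetric extension of
`[h,e] = 4p·e`, `[h,f] = -4p·f`, `[e,f] = (p/2)·h'`, `[h,h'] = [h',e] = [h',f] = 0`. -/
def br (x y : BoundaryA p) : BoundaryA p :=
  mk' 0
      (p / 2 * (cE x * cF y - cF x * cE y))
      (4 * p * (cH x * cE y - cE x * cH y))
      (-(4 * p) * (cH x * cF y - cF x * cH y))

lemma ext4 {x y : BoundaryA p} (h1 : cH x = cH y) (h2 : cH' x = cH' y)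
    (h3 : cE x = cE y) (h4 : cF x = cF y) : x = y := by
  exact Prod.ext h1 (Prod.ext h2 (Prod.ext h3 h4))

@[simp] lemma cH_mk (a b c d : ℂ) : cH (mk' a b c d : BoundaryA p) = a := rfl
@[simp] lemma cH'_mk (a b c d : ℂ) : cH' (mk' a b c d : BoundaryA p) = b := rfl
@[simp] lemma cE_mk (a b c d : ℂ) : cE (mk' a b c d : BoundaryA p) = c := rfl
@[simp] lemma cF_mk (a b c d : ℂ) : cF (mk' a b c d : BoundaryA p) = d := rfl

@[simp] lemma cH_add (x y : BoundaryA p) : cH (x + y) = cH x + cH y := rfl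
@[simp] lemma cH'_add (x y : BoundaryA p) : cH' (x + y) = cH' x + cH' y := rfl
@[simp] lemma cE_add (x y : BoundaryA p) : cE (x + y) = cE x + cE y := rfl
@[simp] lemma cF_add (x y : BoundaryA p) : cF (x + y) = cF x + cF y := rfl

@[simp] lemma cH_smul (t : ℂ) (x : BoundaryA p) : cH (t • x) = t * cH x := rfl
@[simp] lemma cH'_smul (t : ℂ) (x : BoundaryA p) : cH' (t • x) = t * cH' x := rfl
@[simp] lemma cE_smul (t : ℂ) (x : BoundaryA p) : cE (t • x) = t * cE x := rfl
@[simp] lemma cF_smul (t : ℂ) (x : BoundaryA p) : cF (t • x) = t * cF x := rfl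

@[simp] lemma cH_neg (x : BoundaryA p) : cH (-x) = -cH x := rfl
@[simp] lemma cH'_neg (x : BoundaryA p) : cH' (-x) = -cH' x := rfl
@[simp] lemma cE_neg (x : BoundaryA p) : cE (-x) = -cE x := rfl
@[simp] lemma cF_neg (x : BoundaryA p) : cF (-x) = -cF x := rfl

@[simp] lemma cH_zero : cH (0 : BoundaryA p) = 0 := rfl
@[simp] lemma cH'_zero : cH' (0 : BoundaryA p) = 0 := rfl
@[simp] lemma cE_zero : cE (0 : BoundaryA p) = 0 := rfl
@[simp] lemma cF_zero : cF (0 : BoundaryA p) = 0 := rfl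

instance : LieRing (BoundaryA p) where
  bracket := br
  add_lie x y z := by refine ext4 ?_ ?_ ?_ ?_ <;> simp only [br, cH_mk, cH'_mk, cE_mk, cF_mk, cH_add, cH'_add, cE_add, cF_add, cH_zero, cH'_zero, cE_zero, cF_zero] <;> ring
  lie_add x y z := by refine ext4 ?_ ?_ ?_ ?_ <;> simp only [br, cH_mk, cH'_mk, cE_mk, cF_mk, cH_add, cH'_add, cE_add, cF_add, cH_zero, cH'_zero, cE_zero, cF_zero] <;> ring
  lie_self x := by refine ext4 ?_ ?_ ?_ ?_ <;> simp only [br, cH_mk, cH'_mk, cE_mk, cF_mk, cH_add, cH'_add, cE_add, cF_add, cH_zero, cH'_zero, cE_zero, cF_zero] <;> ring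
  leibniz_lie x y z := by refine ext4 ?_ ?_ ?_ ?_ <;> simp only [br, cH_mk, cH'_mk, cE_mk, cF_mk, cH_add, cH'_add, cE_add, cF_add, cH_zero, cH'_zero, cE_zero, cF_zero] <;> ring

instance : LieAlgebra ℂ (BoundaryA p) where
  lie_smul t x y := by refine ext4 ?_ ?_ ?_ ?_ <;> simp only [Bracket.bracket, br, cH_mk, cH'_mk, cE_mk, cF_mk, cH_smul, cH'_smul, cE_smul, cF_smul] <;> ring

@[simp] lemma lie_def (x y : BoundaryA p) : ⁅x, y⁆ = br x y := rfl

lemma lie_h_e : ⁅(h : BoundaryA p), (e : BoundaryA p)⁆ = (4 * p) • e := by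
  refine ext4 ?_ ?_ ?_ ?_ <;> simp [br, h, e]

lemma lie_h_f : ⁅(h : BoundaryA p), (f : BoundaryA p)⁆ = (-(4 * p)) • f := by
  refine ext4 ?_ ?_ ?_ ?_ <;> simp [br, h, f]

lemma lie_e_f : ⁅(e : BoundaryA p), (f : BoundaryA p)⁆ = (p / 2) • h' := by
  refine ext4 ?_ ?_ ?_ ?_ <;> simp [br, h', e, f]

lemma lie_h_h' : ⁅(h : BoundaryA p), (h' : BoundaryA p)⁆ = 0 := by
  refine ext4 ?_ ?_ ?_ ?_ <;> simp [br, h, h']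

end BoundaryA

namespace BoundaryA

variable {p : ℂ}

lemma mem_span_he {x : BoundaryA p} :
    x ∈ Submodule.span ℂ ({h, e} : Set (BoundaryA p)) ↔ cH' x = 0 ∧ cF x = 0 := by
  constructor
  · intro hx
    induction hx using Submodule.span_induction with
    | mem y hy =>
        simp only [Set.mem_insert_iff, Set.mem_singleton_iff] at hy
        rcases hy with rfl | rfl <;> exact ⟨rfl, rfl⟩
    | zero => exact ⟨rfl, rfl⟩
    | add a b _ _ ha hb => exact ⟨by simp [ha.1, hb.1], by simp [ha.2, hb.2]⟩
    | smul t a _ ha => exact ⟨by simp [ha.1], by simp [ha.2]⟩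
  · rintro ⟨h1, h2⟩
    have hx : x = cH x • h + cE x • e := by
      refine ext4 ?_ ?_ ?_ ?_ <;> simp [h, e, h1, h2]
    rw [hx]
    exact add_mem (Submodule.smul_mem _ _ (Submodule.subset_span (by simp)))
      (Submodule.smul_mem _ _ (Submodule.subset_span (by simp)))

end BoundaryA

/-- The subalgebra `b = span{h, e}` of the boundary Lie algebra `a` (the Borel
subalgebra `b(2)`). -/
def bAlg (p : ℂ) : LieSubalgebra ℂ (BoundaryA p) :=
  { Submodule.span ℂ ({BoundaryA.h, BoundaryA.e} : Set (BoundaryA p)) with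
    lie_mem' := by
      intro x y hx hy
      have hx' := BoundaryA.mem_span_he.mp hx
      have hy' := BoundaryA.mem_span_he.mp hy
      refine BoundaryA.mem_span_he.mpr ⟨?_, ?_⟩ <;>
        simp [BoundaryA.br, hx'.1, hx'.2, hy'.1, hy'.2] }

/-- The subspace `n = span{h', f}` of the boundary Lie algebra `a`. -/
def nSpan (p : ℂ) : Submodule ℂ (BoundaryA p) :=
  Submodule.span ℂ ({BoundaryA.h', BoundaryA.f} : Set (BoundaryA p))

lemma mem_nSpan_iff {p : ℂ} {x : BoundaryA p} :
    x ∈ nSpan p ↔ BoundaryA.cH x = 0 ∧ BoundaryA.cE x = 0 := by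
  unfold nSpan
  constructor
  · intro hx
    induction hx using Submodule.span_induction with
    | mem y hy =>
        simp only [Set.mem_insert_iff, Set.mem_singleton_iff] at hy
        rcases hy with rfl | rfl <;> exact ⟨rfl, rfl⟩
    | zero => exact ⟨rfl, rfl⟩
    | add a b _ _ ha hb => exact ⟨by simp [ha.1, hb.1], by simp [ha.2, hb.2]⟩
    | smul t a _ ha => exact ⟨by simp [ha.1], by simp [ha.2]⟩
  · rintro ⟨h1, h2⟩
    have hx : x = BoundaryA.cH' x • BoundaryA.h' + BoundaryA.cF x • BoundaryA.f := by
      refine BoundaryA.ext4 ?_ ?_ ?_ ?_ <;> simp [BoundaryA.h', BoundaryA.f, h1, h2]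
    rw [hx]
    exact add_mem (Submodule.smul_mem _ _ (Submodule.subset_span (by simp)))
      (Submodule.smul_mem _ _ (Submodule.subset_span (by simp)))

lemma mem_bAlg_iff {p : ℂ} {x : BoundaryA p} :
    x ∈ bAlg p ↔ BoundaryA.cH' x = 0 ∧ BoundaryA.cF x = 0 :=
  BoundaryA.mem_span_he

def bH (p : ℂ) : bAlg p := ⟨BoundaryA.h, mem_bAlg_iff.mpr ⟨rfl, rfl⟩⟩
def bE (p : ℂ) : bAlg p := ⟨BoundaryA.e, mem_bAlg_iff.mpr ⟨rfl, rfl⟩⟩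

lemma bAlg_decomp {p : ℂ} (y : bAlg p) :
    y = BoundaryA.cH (y : BoundaryA p) • bH p + BoundaryA.cE (y : BoundaryA p) • bE p := by
  have hy := mem_bAlg_iff.mp y.2
  apply Subtype.ext
  refine BoundaryA.ext4 ?_ ?_ ?_ ?_ <;>
    simp [bH, bE, BoundaryA.h, BoundaryA.e, hy.1, hy.2]

/-- The map sending `h'` to `8 h*` and `f` to `e*`. -/
def phiEquiv (p : ℂ) : nSpan p ≃ₗ[ℂ] Module.Dual ℂ (bAlg p) where
  toFun v :=
    { toFun := fun y => 8 * BoundaryA.cH' (v : BoundaryA p) * BoundaryA.cH (y : BoundaryA p)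
        + BoundaryA.cF (v : BoundaryA p) * BoundaryA.cE (y : BoundaryA p)
      map_add' := fun y z => by simp; ring
      map_smul' := fun t y => by simp; ring }
  map_add' v w := by
    ext y
    simp
    ring
  map_smul' t v := by
    ext y
    simp
    ring
  invFun ξ := ⟨BoundaryA.mk' 0 (ξ (bH p) / 8) 0 (ξ (bE p)), mem_nSpan_iff.mpr ⟨rfl, rfl⟩⟩
  left_inv v := by
    have hv := mem_nSpan_iff.mp v.2
    apply Subtype.ext
    refine BoundaryA.ext4 ?_ ?_ ?_ ?_ <;>
      simp [bH, bE, BoundaryA.h, BoundaryA.e, hv.1, hv.2]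
  right_inv ξ := by
    ext y
    conv_rhs => rw [bAlg_decomp y, map_add, map_smul, map_smul]
    simp
    ring

lemma phiEquiv_apply {p : ℂ} (v : nSpan p) (y : bAlg p) :
    phiEquiv p v y = 8 * BoundaryA.cH' (v : BoundaryA p) * BoundaryA.cH (y : BoundaryA p)
        + BoundaryA.cF (v : BoundaryA p) * BoundaryA.cE (y : BoundaryA p) := rfl

/-- `n = span{h', f}` is invariant under the adjoint action of the subalgebra
`b = span{h, e}`, and as a Lie module over `b` it is isomorphic to the coadjoint module
`b*` (with action `(x·ξ)(y) = -ξ([x,y])`).  Consequently `a` is the cotangent bundle Lie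
algebra `b ⋉ b*` of the two-dimensional Borel algebra. -/
theorem statement3 (p : ℂ) (hp : p ≠ 0) :
    (∀ x ∈ bAlg p, ∀ v ∈ nSpan p, ⁅x, v⁆ ∈ nSpan p) ∧
    ∃ φ : nSpan p ≃ₗ[ℂ] Module.Dual ℂ (bAlg p),
      ∀ (x : bAlg p) (v : nSpan p)
        (hm : ⁅(x : BoundaryA p), (v : BoundaryA p)⁆ ∈ nSpan p) (y : bAlg p),
        φ ⟨⁅(x : BoundaryA p), (v : BoundaryA p)⁆, hm⟩ y = - φ v ⁅x, y⁆ := by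
  refine ⟨?_, phiEquiv p, ?_⟩
  · intro x hx v hv
    have hx' := mem_bAlg_iff.mp hx
    have hv' := mem_nSpan_iff.mp hv
    refine mem_nSpan_iff.mpr ⟨?_, ?_⟩ <;> simp [BoundaryA.br, hv'.1, hv'.2]
  · intro x v hm y
    have hx := mem_bAlg_iff.mp x.2
    rw [phiEquiv_apply, phiEquiv_apply, LieSubalgebra.coe_bracket]
    simp only [BoundaryA.lie_def, BoundaryA.br, BoundaryA.cH_mk, BoundaryA.cH'_mk,
      BoundaryA.cE_mk, BoundaryA.cF_mk, hx.1, hx.2]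
    ring
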